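/- Let R be a commutative ring and let M be a finitely generated free R-module. Then M is regularly alternate: for every n ∈ ℕ, the kernel of the antisymmetrizer a_n : M^{⊗n} → M^{⊗n} equals the kernel of the canonical projection π_n : M^{⊗n} → ⋀^n_R M. -/

import Mathlib

open TensorProduct

/-- The antisymmetrizer `a_n : M^{⊗n} → M^{⊗n}`, sending an elementary tensor
`m₁ ⊗ ⋯ ⊗ mₙ` to `∑_{σ ∈ Σₙ} sgn(σ) m_{σ(1)} ⊗ ⋯ ⊗ m_{σ(n)}`. -/
noncomputable def antisymmetrizer (R M : Type*) [CommRing R] [AddCommGroup M] [Module R M]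
    (n : ℕ) : (⨂[R]^n M) →ₗ[R] ⨂[R]^n M :=
  ∑ σ : Equiv.Perm (Fin n),
    (Equiv.Perm.sign σ : ℤ) •
      (PiTensorProduct.reindex R (fun _ : Fin n => M) σ.symm).toLinearMap

/-- The canonical projection `π_n : M^{⊗n} → ⋀^n_R M` induced by the alternating
multilinear map `(m₁, …, mₙ) ↦ m₁ ∧ ⋯ ∧ mₙ`. -/
noncomputable def exteriorProjection (R M : Type*) [CommRing R] [AddCommGroup M] [Module R M]
    (n : ℕ) : (⨂[R]^n M) →ₗ[R] (⋀[R]^n M) :=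
  LinearMap.codRestrict (⋀[R]^n M)
    (PiTensorProduct.lift (ExteriorAlgebra.ιMulti R n).toMultilinearMap)
    (fun x => by
      induction x using PiTensorProduct.induction_on with
      | smul_tprod r f =>
          simpa using Submodule.smul_mem _ r
            (ExteriorAlgebra.ιMulti_range R n (Set.mem_range_self f))
      | add x y hx hy => simpa using Submodule.add_mem _ hx hy)

section

variable (R M : Type*) [CommRing R] [AddCommGroup M] [Module R M] (n : ℕ)

lemma exteriorProjection_tprod (v : Fin n → M) :
    exteriorProjection R M n (PiTensorProduct.tprod R v) = exteriorPower.ιMulti R n v := by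
  ext
  simp [exteriorProjection]

lemma exteriorPower.toTensorPower_comp_exteriorProjection :
    exteriorPower.toTensorPower R M n ∘ₗ exteriorProjection R M n = antisymmetrizer R M n := by
  ext v
  simp [exteriorProjection_tprod, antisymmetrizer, Units.smul_def]

lemma exteriorPower.pairingDual_ιMulti_apply (f : Fin n → Module.Dual R M) (x : ⋀[R]^n M) :
    exteriorPower.pairingDual R M n (exteriorPower.ιMulti R n f) x =
      TensorPower.multilinearMapToDual R M n f (exteriorPower.toTensorPower R M n x) := by
  rw [exteriorPower.pairingDual, exteriorPower.alternatingMapLinearEquiv_apply_ιMulti]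
  rfl

lemma exteriorPower.toTensorPower_injective [Module.Free R M] :
    Function.Injective (exteriorPower.toTensorPower R M n) := by
  classical
  obtain ⟨I, b⟩ := Module.Free.exists_basis R M
  let : LinearOrder I := linearOrderOfSTO WellOrderingRel
  rw [injective_iff_map_eq_zero]
  intro x hx
  refine (b.exteriorPower n).ext_elem fun s => ?_
  rw [exteriorPower.basis_repr_apply, exteriorPower.ιMultiDual, exteriorPower.ιMulti_family,
    exteriorPower.pairingDual_ιMulti_apply, hx]
  simp

end

/-- A finitely generated free module over a commutative ring is regularly alternate: for
every `n`, the kernel of the antisymmetrizer on `M^{⊗n}` coincides with the kernel of the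
canonical projection `M^{⊗n} → ⋀^n_R M`. -/
theorem regularly_alternate_of_finite_free
    (R M : Type*) [CommRing R] [AddCommGroup M] [Module R M]
    [Module.Free R M] [Module.Finite R M] (n : ℕ) :
    LinearMap.ker (antisymmetrizer R M n) = LinearMap.ker (exteriorProjection R M n) := by
  rw [← exteriorPower.toTensorPower_comp_exteriorProjection]
  exact LinearMap.ker_comp_of_ker_eq_bot _
    (LinearMap.ker_eq_bot.mpr (exteriorPower.toTensorPower_injective R M n))
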